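/- arXiv:2604.15393 — 2 statements merged into one kernel-verified Lean document; each statement's English description precedes it below -/
import Mathlib

section
/- Belief-space discretization error bound on the belief grid: assume each exact value function V_t is L_t-Lipschitz on Δ_M with respect to the sup norm ‖·‖_∞. Then for every t = 0,…,H, sup_{b∈B} |V_t(b) − V̂_t(b)| ≤ δ_B · Σ_{s=t+1}^{H} L_s. -/
open Finset ComplexOrder

/-- The belief simplex `Δ_M ⊆ ℝ^M`. -/
def simplex (M : ℕ) : Set (Fin M → ℝ) :=
  {b | (∀ i, 0 ≤ b i) ∧ ∑ i, b i = 1}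

/-- The real number `Re Tr(E ρ)`, the Born-rule likelihood value. -/
noncomputable def trRe {d : ℕ} (E ρ : Matrix (Fin d) (Fin d) ℂ) : ℝ :=
  ((E * ρ).trace).re

/-- Observation probability `ObsProb(o | b, a) = Σ_j b j · Tr(E_o^{(a)} ρ_j)`. -/
noncomputable def obsProb {d M : ℕ} {O A : Type}
    (E : A → O → Matrix (Fin d) (Fin d) ℂ)
    (ρ : Fin M → Matrix (Fin d) (Fin d) ℂ)
    (o : O) (b : Fin M → ℝ) (a : A) : ℝ :=
  ∑ j, b j * trRe (E a o) (ρ j)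

/-- Bayesian posterior `τ(b,a,o)(i) = b i · Tr(E_o^{(a)} ρ_i) / ObsProb(o|b,a)`
(junk value when `ObsProb(o|b,a) = 0`, which only ever appears multiplied by a zero
observation probability). -/
noncomputable def bayes {d M : ℕ} {O A : Type}
    (E : A → O → Matrix (Fin d) (Fin d) ℂ)
    (ρ : Fin M → Matrix (Fin d) (Fin d) ℂ)
    (b : Fin M → ℝ) (a : A) (o : O) : Fin M → ℝ :=
  fun i => b i * trRe (E a o) (ρ i) / obsProb E ρ o b a

/-- Stopping value `StopVal(b) = max_i b i`. -/
noncomputable def stopVal {M : ℕ} [NeZero M] (b : Fin M → ℝ) : ℝ :=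
  univ.sup' univ_nonempty b

/-- The Born-rule likelihood of positive semidefinite matrices is nonnegative. -/
lemma trRe_nonneg {d : ℕ} {E ρ : Matrix (Fin d) (Fin d) ℂ}
    (hE : E.PosSemidef) (hρ : ρ.PosSemidef) : 0 ≤ trRe E ρ := by
  open scoped MatrixOrder in
  obtain ⟨C, rfl⟩ := CStarAlgebra.nonneg_iff_eq_star_mul_self.mp hE.nonneg
  have h := (hρ.mul_mul_conjTranspose_same C).trace_nonneg
  rw [Matrix.trace_mul_comm, ← Matrix.mul_assoc] at h
  exact (Complex.le_def.mp h).1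

/-- Likelihoods sum to one over the outcomes of a POVM. -/
lemma sum_trRe_eq_one {d : ℕ} {O : Type} [Fintype O]
    {E : O → Matrix (Fin d) (Fin d) ℂ} {ρ : Matrix (Fin d) (Fin d) ℂ}
    (hE : ∑ o, E o = 1) (hρ : ρ.trace = 1) : ∑ o, trRe (E o) ρ = 1 := by
  simp only [trRe]
  rw [← Complex.re_sum, ← Matrix.trace_sum, ← Finset.sum_mul, hE, one_mul, hρ, Complex.one_re]

section Belief

variable {d M : ℕ} {O A : Type} {ρ : Fin M → Matrix (Fin d) (Fin d) ℂ}
  {E : A → O → Matrix (Fin d) (Fin d) ℂ} {b : Fin M → ℝ}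

lemma obsProb_nonneg (hρ : ∀ i, (ρ i).PosSemidef) (hE : ∀ a o, (E a o).PosSemidef)
    (hb : b ∈ simplex M) (o : O) (a : A) : 0 ≤ obsProb E ρ o b a :=
  Finset.sum_nonneg fun j _ => mul_nonneg (hb.1 j) (trRe_nonneg (hE a o) (hρ j))

lemma sum_obsProb_eq_one [Fintype O] (hρ : ∀ i, (ρ i).trace = 1)
    (hE : ∀ a, ∑ o, E a o = 1) (hb : b ∈ simplex M) (a : A) :
    ∑ o, obsProb E ρ o b a = 1 := by
  simp only [obsProb]
  rw [Finset.sum_comm]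
  simp_rw [← Finset.mul_sum, sum_trRe_eq_one (hE a) (hρ _), mul_one]
  exact hb.2

/-- The Bayesian posterior of an outcome of nonzero probability is a belief. -/
lemma bayes_mem_simplex (hρ : ∀ i, (ρ i).PosSemidef) (hE : ∀ a o, (E a o).PosSemidef)
    (hb : b ∈ simplex M) {a : A} {o : O} (h : obsProb E ρ o b a ≠ 0) :
    bayes E ρ b a o ∈ simplex M := by
  refine ⟨fun i => div_nonneg (mul_nonneg (hb.1 i) (trRe_nonneg (hE a o) (hρ i)))
    (obsProb_nonneg hρ hE hb o a), ?_⟩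
  simp only [bayes]
  rw [← Finset.sum_div]
  exact div_self h

end Belief

lemma abs_sup'_sub_sup'_le {ι : Type*} {s : Finset ι} (hs : s.Nonempty) {f g : ι → ℝ} {ε : ℝ}
    (h : ∀ i ∈ s, |f i - g i| ≤ ε) : |s.sup' hs f - s.sup' hs g| ≤ ε := by
  rw [abs_sub_le_iff, sub_le_iff_le_add, sub_le_iff_le_add]
  constructor <;> refine Finset.sup'_le _ _ fun i hi => ?_
  · linarith [(abs_sub_le_iff.mp (h i hi)).1, Finset.le_sup' g hi]
  · linarith [(abs_sub_le_iff.mp (h i hi)).2, Finset.le_sup' f hi]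

/-- Weighted averages of pointwise `ε`-close functions are `ε`-close; the functions need only be
close where the weight does not vanish. -/
lemma abs_sum_mul_sub_sum_mul_le {ι : Type*} {s : Finset ι} {w f g : ι → ℝ} {ε : ℝ}
    (hw : ∀ i ∈ s, 0 ≤ w i) (hw_sum : ∑ i ∈ s, w i = 1)
    (h : ∀ i ∈ s, w i ≠ 0 → |f i - g i| ≤ ε) :
    |∑ i ∈ s, w i * f i - ∑ i ∈ s, w i * g i| ≤ ε := by
  rw [← Finset.sum_sub_distrib]
  calc |∑ i ∈ s, (w i * f i - w i * g i)| ≤ ∑ i ∈ s, w i * ε := by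
        refine (Finset.abs_sum_le_sum_abs _ _).trans (Finset.sum_le_sum fun i hi => ?_)
        rw [← mul_sub, abs_mul, abs_of_nonneg (hw i hi)]
        rcases eq_or_ne (w i) 0 with h0 | h0
        · simp [h0]
        · exact mul_le_mul_of_nonneg_left (h i hi h0) (hw i hi)
    _ = ε := by rw [← Finset.sum_mul, hw_sum, one_mul]

/-- Belief-space discretization error bound on the belief grid: if each exact value
function `V_t` is `L_t`-Lipschitz on `Δ_M` w.r.t. the sup norm, then for every
`t = 0,…,H` and every grid point `b ∈ B`,
`|V_t(b) − V̂_t(b)| ≤ δ_B · Σ_{s=t+1}^{H} L_s`. -/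
theorem belief_discretization_error
    (d M : ℕ) (hd : 0 < d) [NeZero M]
    (O A : Type) [Fintype O] [Nonempty O] [Fintype A] [Nonempty A]
    (ρ : Fin M → Matrix (Fin d) (Fin d) ℂ)
    (hρpsd : ∀ i, (ρ i).PosSemidef) (hρtr : ∀ i, (ρ i).trace = 1)
    (E : A → O → Matrix (Fin d) (Fin d) ℂ)
    (hEpsd : ∀ a o, (E a o).PosSemidef) (hEsum : ∀ a, ∑ o, E a o = 1)
    (H : ℕ) (c : ℝ)
    (B : Finset (Fin M → ℝ)) (hBne : B.Nonempty) (hBsub : ∀ x ∈ B, x ∈ simplex M)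
    (proj : (Fin M → ℝ) → (Fin M → ℝ)) (hproj : ∀ x ∈ simplex M, proj x ∈ B)
    (δB : ℝ) (hδB : ∀ x ∈ simplex M, ‖x - proj x‖ ≤ δB)
    (V : ℕ → (Fin M → ℝ) → ℝ)
    (hVH : ∀ b ∈ simplex M, V H b = stopVal b)
    (hVrec : ∀ t < H, ∀ b ∈ simplex M,
      V t b = max (stopVal b)
        (univ.sup' univ_nonempty fun a =>
          -c + ∑ o, obsProb E ρ o b a * V (t + 1) (bayes E ρ b a o)))
    (Vhat : ℕ → (Fin M → ℝ) → ℝ)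
    (hVhatH : ∀ b ∈ B, Vhat H b = stopVal b)
    (hVhatrec : ∀ t < H, ∀ b ∈ B,
      Vhat t b = max (stopVal b)
        (univ.sup' univ_nonempty fun a =>
          -c + ∑ o, obsProb E ρ o b a * Vhat (t + 1) (proj (bayes E ρ b a o))))
    (L : ℕ → ℝ) (hL0 : ∀ t, 0 ≤ L t)
    (hLip : ∀ t ≤ H, ∀ b ∈ simplex M, ∀ b' ∈ simplex M,
      |V t b - V t b'| ≤ L t * ‖b - b'‖) :
    ∀ t ≤ H, ∀ b ∈ B,
      |V t b - Vhat t b| ≤ δB * ∑ s ∈ Finset.Icc (t + 1) H, L s := by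
  intro t ht
  induction ht using Nat.decreasingInduction with
  | self =>
    intro b hb
    simp [hVH b (hBsub b hb), hVhatH b hb]
  | of_succ t ht ih =>
    intro b hb
    have hbs := hBsub b hb
    have hsum : ∑ s ∈ Finset.Icc (t + 1) H, L s
        = L (t + 1) + ∑ s ∈ Finset.Icc (t + 1 + 1) H, L s := by
      rw [← Finset.add_sum_Ioc_eq_sum_Icc ht, ← Finset.Icc_add_one_left_eq_Ioc]
    have hstep : ∀ x ∈ simplex M, |V (t + 1) x - Vhat (t + 1) (proj x)|
        ≤ δB * ∑ s ∈ Finset.Icc (t + 1) H, L s := by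
      intro x hx
      calc |V (t + 1) x - Vhat (t + 1) (proj x)|
          ≤ |V (t + 1) x - V (t + 1) (proj x)|
            + |V (t + 1) (proj x) - Vhat (t + 1) (proj x)| := abs_sub_le _ _ _
        _ ≤ L (t + 1) * δB + δB * ∑ s ∈ Finset.Icc (t + 1 + 1) H, L s :=
          add_le_add ((hLip (t + 1) ht x hx _ (hBsub _ (hproj x hx))).trans
            (mul_le_mul_of_nonneg_left (hδB x hx) (hL0 _))) (ih _ (hproj x hx))
        _ = δB * ∑ s ∈ Finset.Icc (t + 1) H, L s := by rw [hsum]; ring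
    rw [hVrec t ht b hbs, hVhatrec t ht b hb, max_comm (stopVal b), max_comm (stopVal b)]
    refine (abs_max_sub_max_le_abs _ _ _).trans (abs_sup'_sub_sup'_le _ fun a _ => ?_)
    rw [add_sub_add_left_eq_sub]
    exact abs_sum_mul_sub_sum_mul_le (fun o _ => obsProb_nonneg hρpsd hEpsd hbs o a)
      (sum_obsProb_eq_one hρtr hEsum hbs a)
      fun o _ ho => hstep _ (bayes_mem_simplex hρpsd hEpsd hbs ho)
end

section
/- Uniform-prior one-step payoff formula: for every φ ∈ ℝ, J_1(1/2, φ) = 1/2 + (1/2)·sin θ·|sin(2φ − θ)|. -/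
/-- One-step payoff of binary quantum state discrimination between `|ψ1⟩ = |0⟩` and
`|ψ2⟩ = cos θ |0⟩ + sin θ |1⟩`, under the projective measurement with angle `φ`:
`J₁(p,φ) = max{p·cos²φ, (1−p)·cos²(θ−φ)} + max{p·sin²φ, (1−p)·sin²(θ−φ)}`. -/
noncomputable def J1 (θ p φ : ℝ) : ℝ :=
  max (p * Real.cos φ ^ 2) ((1 - p) * Real.cos (θ - φ) ^ 2) +
    max (p * Real.sin φ ^ 2) ((1 - p) * Real.sin (θ - φ) ^ 2)

theorem sin_sq_sub_sin_sq_sub (θ φ : ℝ) :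
    Real.sin φ ^ 2 - Real.sin (θ - φ) ^ 2 = Real.sin θ * Real.sin (2 * φ - θ) := by
  have h₁ : Real.sin θ = Real.sin (φ + (θ - φ)) := by ring_nf
  have h₂ : Real.sin (2 * φ - θ) = Real.sin (φ - (θ - φ)) := by ring_nf
  rw [h₁, h₂, Real.sin_add φ (θ - φ), Real.sin_sub φ (θ - φ)]
  linear_combination
    Real.sin (θ - φ) ^ 2 * Real.sin_sq_add_cos_sq φ -
      Real.sin φ ^ 2 * Real.sin_sq_add_cos_sq (θ - φ)

/-- Uniform-prior one-step payoff formula: for every `φ ∈ ℝ`,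
`J₁(1/2, φ) = 1/2 + (1/2)·sin θ·|sin(2φ − θ)|`. -/
theorem uniform_prior_one_step_payoff
    (θ : ℝ) (hθ0 : 0 < θ) (hθ1 : θ < Real.pi / 2) :
    ∀ φ : ℝ,
      J1 θ (1 / 2) φ = 1 / 2 + 1 / 2 * Real.sin θ * |Real.sin (2 * φ - θ)| := by
  intro φ
  have h := sin_sq_sub_sin_sq_sub θ φ
  have hs : 0 ≤ Real.sin θ := (Real.sin_pos_of_pos_of_lt_pi hθ0 (by linarith)).le
  have hφ := Real.sin_sq_add_cos_sq φ
  have hψ := Real.sin_sq_add_cos_sq (θ - φ)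
  unfold J1
  rw [mul_assoc, ← abs_of_nonneg hs, ← abs_mul, ← h]
  rcases le_total (Real.sin (θ - φ) ^ 2) (Real.sin φ ^ 2) with hle | hle
  · rw [max_eq_right (by linarith), max_eq_left (by linarith), abs_of_nonneg (by linarith)]
    linarith
  · rw [max_eq_left (by linarith), max_eq_right (by linarith), abs_of_nonpos (by linarith)]
    linarith
end
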